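/- Let m be a positive natural number. Then there do not exist m×m complex matrices A, B, C with A² = 1, B² = 1, C² = 1, A²*B + A*B*A + B*A² = 0, and B²*A + B*A*B + A*B² = 0. -/

import Mathlib

theorem no_gamma_matrices_n3 (m : ℕ) (hm : 0 < m) :
    ¬ ∃ A B C : Matrix (Fin m) (Fin m) ℂ,
      A ^ 2 = 1 ∧ B ^ 2 = 1 ∧ C ^ 2 = 1 ∧
      A ^ 2 * B + A * B * A + B * A ^ 2 = 0 ∧
      B ^ 2 * A + B * A * B + A * B ^ 2 = 0 := by
  rintro ⟨A, B, C, hA, hB, -, h, -⟩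
  rw [hA, one_mul, mul_one] at h
  have h1 : A * B * A = -(B + B) := by
    rw [eq_neg_iff_add_eq_zero, ← h]; abel
  have h2 : (A * B * A) * (A * B * A) = 1 := by
    calc (A * B * A) * (A * B * A) = A * B * A ^ 2 * B * A := by noncomm_ring
      _ = A * B ^ 2 * A := by rw [hA]; noncomm_ring
      _ = A ^ 2 := by rw [hB]; noncomm_ring
      _ = 1 := hA
  have h3 : B ^ 2 + B ^ 2 + B ^ 2 + B ^ 2 = 1 := by
    rw [← h2, h1]; noncomm_ring
  rw [hB] at h3
  have h4 := congrFun (congrFun h3 ⟨0, hm⟩) ⟨0, hm⟩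
  simp only [Matrix.add_apply, Matrix.one_apply_eq] at h4
  norm_num at h4
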